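/- arXiv:2007.05166 — 2 statements merged into one kernel-verified Lean document; each statement's English description precedes it below -/
import Mathlib

section
/- Consider the hierarchical chain model, with the tail functions T_l defined by T_L(w, x) = p_X(w, x) and T_l(w, x) = ∫ p_{l+1}(w, e) · T_{l+1}(f_{l+1}(w, e), x) dμ_{l+1}(e) for l = L−1, …, 0, and for 0 ≤ l ≤ L define the partial marginals M_l(ε_1,…,ε_l, x) = ∫⋯∫ J(ε, x) dμ_{l+1}(ε_{l+1}) ⋯ dμ_L(ε_L) (so M_L = J and M_0(x) is the marginal likelihood of x). Then for each l ∈ {1,…,L} the measurable function g_l : Z_{l-1} × E_l × X → [0, ∞) defined by g_l(w, e, x) = p_l(w, e) · T_l(f_l(w, e), x) / T_{l-1}(w, x) whenever 0 < T_{l-1}(w, x) < ∞ (and 0 otherwise) satisfies: (i) M_l(ε_1,…,ε_l, x) = g_l(z_{l-1}(ε), ε_l, x) · M_{l-1}(ε_1,…,ε_{l-1}, x) for all (ε, x) with 0 < T_{l-1}(z_{l-1}(ε), x) < ∞, and (ii) ∫ g_l(w, e, x) dμ_l(e) = 1 for all (w, x) with 0 < T_{l-1}(w, x) < ∞. Hence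 the exact conditional posterior density p(ε_l | ε_{<l}, x) = M_l / M_{l-1} depends on the preceding noise variables ε_{<l} only through the latent code z_{l-1}. -/
open MeasureTheory
open scoped ENNReal NNReal Classical

/-- The latent codes `z_l(ε)` of the hierarchical chain model, defined recursively from the
initial code `z0` by `z_l(ε) = f_l (z_{l-1}(ε)) (ε_l)`. -/
def latentCode {L : ℕ} {E : Fin L → Type*} {Z : Fin (L + 1) → Type*}
    (z0 : Z 0) (f : ∀ l : Fin L, Z l.castSucc → E l → Z l.succ)
    (ε : ∀ l : Fin L, E l) : ∀ l : Fin (L + 1), Z l :=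
  fun l => Fin.induction (motive := fun l => Z l) z0 (fun i zi => f i zi (ε i)) l

/-- The tail functions `T_l : Z_l × X → [0, ∞]`, defined by downward recursion:
`T_L(w, x) = p_X(w, x)` and `T_l(w, x) = ∫ p_{l+1}(w, e) ⬝ T_{l+1}(f_{l+1}(w, e), x) dμ_{l+1}(e)`. -/
noncomputable def tailFn {L : ℕ} {E : Fin L → Type*} [∀ i, MeasurableSpace (E i)]
    {Z : Fin (L + 1) → Type*} {X : Type*}
    (μE : ∀ i, Measure (E i))
    (f : ∀ l : Fin L, Z l.castSucc → E l → Z l.succ)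
    (p : ∀ l : Fin L, Z l.castSucc → E l → ℝ≥0)
    (pX : Z (Fin.last L) → X → ℝ≥0) :
    ∀ l : Fin (L + 1), Z l → X → ℝ≥0∞ :=
  Fin.reverseInduction (motive := fun l => Z l → X → ℝ≥0∞)
    (fun w x => (pX w x : ℝ≥0∞))
    (fun i T w x => ∫⁻ e, (p i w e : ℝ≥0∞) * T (f i w e) x ∂ μE i)

/-- The iterated integral over the tail noise variables `ε_{l+1}, …, ε_L`:
`tailIntegral μE l F ε = ∫ ⋯ ∫ F(ε₁,…,ε_l, ε_{l+1}, …, ε_L) dμ_{l+1}(ε_{l+1}) ⋯ dμ_L(ε_L)`. -/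
noncomputable def tailIntegral {L : ℕ} {E : Fin L → Type*} [∀ i, MeasurableSpace (E i)]
    (μE : ∀ i, Measure (E i)) :
    Fin (L + 1) → ((∀ i, E i) → ℝ≥0∞) → ((∀ i, E i) → ℝ≥0∞) :=
  Fin.reverseInduction (motive := fun _ => ((∀ i, E i) → ℝ≥0∞) → ((∀ i, E i) → ℝ≥0∞))
    (fun F => F)
    (fun j ih F ε => ∫⁻ e, ih F (Function.update ε j e) ∂ μE j)

/-- The joint density `J(ε, x) = (∏_{l=1}^{L} p_l(z_{l-1}(ε), ε_l)) ⬝ p_X(z_L(ε), x)` of the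
hierarchical chain model. -/
noncomputable def jointDensity {L : ℕ} {E : Fin L → Type*}
    {Z : Fin (L + 1) → Type*} {X : Type*} (z0 : Z 0)
    (f : ∀ l : Fin L, Z l.castSucc → E l → Z l.succ)
    (p : ∀ l : Fin L, Z l.castSucc → E l → ℝ≥0)
    (pX : Z (Fin.last L) → X → ℝ≥0) (ε : ∀ i, E i) (x : X) : ℝ≥0∞ :=
  (∏ k : Fin L, (p k (latentCode z0 f ε k.castSucc) (ε k) : ℝ≥0∞)) *
    (pX (latentCode z0 f ε (Fin.last L)) x : ℝ≥0∞)

/-- The layer-wise posterior density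
`g_l(w, e, x) = p_l(w, e) ⬝ T_l(f_l(w, e), x) / T_{l-1}(w, x)` whenever
`0 < T_{l-1}(w, x) < ∞`, and `0` otherwise. -/
noncomputable def layerG {L : ℕ} {E : Fin L → Type*} [∀ i, MeasurableSpace (E i)]
    {Z : Fin (L + 1) → Type*} {X : Type*}
    (μE : ∀ i, Measure (E i))
    (f : ∀ l : Fin L, Z l.castSucc → E l → Z l.succ)
    (p : ∀ l : Fin L, Z l.castSucc → E l → ℝ≥0)
    (pX : Z (Fin.last L) → X → ℝ≥0)
    (l : Fin L) (w : Z l.castSucc) (e : E l) (x : X) : ℝ≥0∞ :=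
  if 0 < tailFn μE f p pX l.castSucc w x ∧ tailFn μE f p pX l.castSucc w x < ∞ then
    (p l w e : ℝ≥0∞) * tailFn μE f p pX l.succ (f l w e) x / tailFn μE f p pX l.castSucc w x
  else 0

theorem latentCode_succ {L : ℕ} {E : Fin L → Type*} {Z : Fin (L + 1) → Type*}
    (z0 : Z 0) (f : ∀ l : Fin L, Z l.castSucc → E l → Z l.succ) (ε : ∀ l, E l) (l : Fin L) :
    latentCode z0 f ε l.succ = f l (latentCode z0 f ε l.castSucc) (ε l) := by
  simp [latentCode]

/-- The code `z_m(ε)` depends only on the noise variables `ε_1, …, ε_m`. -/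
theorem latentCode_congr {L : ℕ} {E : Fin L → Type*} {Z : Fin (L + 1) → Type*}
    (z0 : Z 0) (f : ∀ l : Fin L, Z l.castSucc → E l → Z l.succ) {ε ε' : ∀ l, E l}
    (m : Fin (L + 1)) (h : ∀ k : Fin L, k.castSucc < m → ε k = ε' k) :
    latentCode z0 f ε m = latentCode z0 f ε' m := by
  induction m using Fin.induction with
  | zero => rfl
  | succ i ih =>
    rw [latentCode_succ, latentCode_succ,
      ih fun k hk => h k (hk.trans Fin.castSucc_lt_succ), h i Fin.castSucc_lt_succ]

theorem filter_castSucc_lt_succ (l : Fin L) :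
    (Finset.univ.filter fun k : Fin L => k.castSucc < l.succ) =
      insert l (Finset.univ.filter fun k : Fin L => k.castSucc < l.castSucc) := by
  ext k
  simp [Fin.castSucc_lt_succ_iff, le_iff_eq_or_lt]

section Tail

variable {L : ℕ} {E : Fin L → Type*} [∀ i, MeasurableSpace (E i)] {Z : Fin (L + 1) → Type*}
  {X : Type*} (μE : ∀ i, Measure (E i)) (f : ∀ l : Fin L, Z l.castSucc → E l → Z l.succ)
  (p : ∀ l : Fin L, Z l.castSucc → E l → ℝ≥0) (pX : Z (Fin.last L) → X → ℝ≥0)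

theorem tailFn_last (w : Z (Fin.last L)) (x : X) :
    tailFn μE f p pX (Fin.last L) w x = pX w x := by
  simp [tailFn]

theorem tailFn_castSucc (l : Fin L) (w : Z l.castSucc) (x : X) :
    tailFn μE f p pX l.castSucc w x =
      ∫⁻ e, (p l w e : ℝ≥0∞) * tailFn μE f p pX l.succ (f l w e) x ∂μE l := by
  simp [tailFn]

theorem tailIntegral_last (F : (∀ i, E i) → ℝ≥0∞) :
    tailIntegral μE (Fin.last L) F = F := by
  simp [tailIntegral]

theorem tailIntegral_castSucc (l : Fin L) (F : (∀ i, E i) → ℝ≥0∞) (ε : ∀ i, E i) :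
    tailIntegral μE l.castSucc F ε =
      ∫⁻ e, tailIntegral μE l.succ F (Function.update ε l e) ∂μE l := by
  simp [tailIntegral]

variable [∀ l, MeasurableSpace (Z l)] [MeasurableSpace X] {f p pX}

theorem measurable_tailFn [∀ i, SigmaFinite (μE i)]
    (hf : ∀ l : Fin L, Measurable (fun q : Z l.castSucc × E l => f l q.1 q.2))
    (hp : ∀ l : Fin L, Measurable (fun q : Z l.castSucc × E l => p l q.1 q.2))
    (hpX : Measurable (fun q : Z (Fin.last L) × X => pX q.1 q.2)) (l : Fin (L + 1)) :
    Measurable (fun q : Z l × X => tailFn μE f p pX l q.1 q.2) := by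
  induction l using Fin.reverseInduction with
  | last => simpa only [tailFn_last] using hpX.coe_nnreal_ennreal
  | cast i ih =>
    simp only [tailFn_castSucc]
    have hq : Measurable (fun q : (Z i.castSucc × X) × E i => (q.1.1, q.2)) := by fun_prop
    exact Measurable.lintegral_prod_right' (f := fun q : (Z i.castSucc × X) × E i =>
        (p i q.1.1 q.2 : ℝ≥0∞) * tailFn μE f p pX i.succ (f i q.1.1 q.2) q.1.2)
      (((hp i).comp hq).coe_nnreal_ennreal.mul
        (ih.comp (((hf i).comp hq).prodMk (measurable_snd.comp measurable_fst))))

theorem measurable_prior_mul_tailFn [∀ i, SigmaFinite (μE i)]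
    (hf : ∀ l : Fin L, Measurable (fun q : Z l.castSucc × E l => f l q.1 q.2))
    (hp : ∀ l : Fin L, Measurable (fun q : Z l.castSucc × E l => p l q.1 q.2))
    (hpX : Measurable (fun q : Z (Fin.last L) × X => pX q.1 q.2)) (l : Fin L) :
    Measurable (fun q : Z l.castSucc × E l × X =>
      (p l q.1 q.2.1 : ℝ≥0∞) * tailFn μE f p pX l.succ (f l q.1 q.2.1) q.2.2) := by
  have hq : Measurable (fun q : Z l.castSucc × E l × X => (q.1, q.2.1)) := by fun_prop
  exact ((hp l).comp hq).coe_nnreal_ennreal.mul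
    ((measurable_tailFn μE hf hp hpX l.succ).comp
      (((hf l).comp hq).prodMk (measurable_snd.comp measurable_snd)))

/-- The partial marginal `M_l` is the product of the first `l` prior factors and `T_l(z_l)`. -/
theorem tailIntegral_jointDensity [∀ i, SigmaFinite (μE i)] (z0 : Z 0)
    (hf : ∀ l : Fin L, Measurable (fun q : Z l.castSucc × E l => f l q.1 q.2))
    (hp : ∀ l : Fin L, Measurable (fun q : Z l.castSucc × E l => p l q.1 q.2))
    (hpX : Measurable (fun q : Z (Fin.last L) × X => pX q.1 q.2)) (l : Fin (L + 1))
    (ε : ∀ i, E i) (x : X) :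
    tailIntegral μE l (fun ε' => jointDensity z0 f p pX ε' x) ε =
      (∏ k : Fin L with k.castSucc < l, (p k (latentCode z0 f ε k.castSucc) (ε k) : ℝ≥0∞)) *
        tailFn μE f p pX l (latentCode z0 f ε l) x := by
  induction l using Fin.reverseInduction generalizing ε with
  | last => simp [tailIntegral_last, tailFn_last, jointDensity, Fin.castSucc_lt_last]
  | cast l ih =>
    have hcode (e : E l) (m : Fin (L + 1)) (hm : m ≤ l.castSucc) :
        latentCode z0 f (Function.update ε l e) m = latentCode z0 f ε m :=
      latentCode_congr z0 f m fun k hk => Function.update_of_ne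
        (fun h => (h ▸ hk.trans_le hm).ne rfl) _ _
    rw [tailIntegral_castSucc, tailFn_castSucc, ← lintegral_const_mul]
    · refine lintegral_congr fun e => ?_
      rw [ih, filter_castSucc_lt_succ, Finset.prod_insert (by simp), latentCode_succ,
        hcode e _ le_rfl, Function.update_self, mul_right_comm, mul_comm]
      congr 1
      refine Finset.prod_congr rfl fun k hk => ?_
      have hk' : k.castSucc < l.castSucc := (Finset.mem_filter.1 hk).2
      rw [hcode e _ hk'.le, Function.update_of_ne (fun h => (h ▸ hk').ne rfl)]
    · exact (measurable_prior_mul_tailFn μE hf hp hpX l).comp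
        (measurable_const.prodMk (measurable_id.prodMk measurable_const))

end Tail

/-- In the hierarchical chain model, writing `M_l(ε_1,…,ε_l, x)` for the partial marginal
obtained by integrating the joint density `J` over the tail noise variables
`ε_{l+1}, …, ε_L`, the function `g_l(w, e, x) = p_l(w, e) ⬝ T_l(f_l(w, e), x) / T_{l-1}(w, x)`
is measurable and satisfies (i) `M_l = g_l(z_{l-1}(ε), ε_l, x) ⬝ M_{l-1}` and
(ii) `∫ g_l(w, e, x) dμ_l(e) = 1`, wherever `0 < T_{l-1} < ∞`.  Hence the exact conditional
posterior density `p(ε_l | ε_{<l}, x) = M_l / M_{l-1}` depends on the preceding noise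
variables only through the latent code `z_{l-1}`. -/
theorem layerG_measurable_marginal_eq_lintegral_eq_one {L : ℕ}
    (E : Fin L → Type*) [∀ i, MeasurableSpace (E i)]
    (μE : ∀ i, Measure (E i)) [∀ i, SigmaFinite (μE i)]
    (Z : Fin (L + 1) → Type*) [∀ l, MeasurableSpace (Z l)] (z0 : Z 0)
    (f : ∀ l : Fin L, Z l.castSucc → E l → Z l.succ)
    (hf : ∀ l : Fin L, Measurable (fun q : Z l.castSucc × E l => f l q.1 q.2))
    (hbij : ∀ (l : Fin L) (w : Z l.castSucc), Function.Bijective (f l w))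
    (p : ∀ l : Fin L, Z l.castSucc → E l → ℝ≥0)
    (hp : ∀ l : Fin L, Measurable (fun q : Z l.castSucc × E l => p l q.1 q.2))
    (hp1 : ∀ (l : Fin L) (w : Z l.castSucc), ∫⁻ e, (p l w e : ℝ≥0∞) ∂ μE l = 1)
    (X : Type*) [MeasurableSpace X] (ν : Measure X) [SigmaFinite ν]
    (pX : Z (Fin.last L) → X → ℝ≥0)
    (hpX : Measurable (fun q : Z (Fin.last L) × X => pX q.1 q.2))
    (hpX1 : ∀ z : Z (Fin.last L), ∫⁻ x, (pX z x : ℝ≥0∞) ∂ ν = 1) :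
    ∀ l : Fin L,
      (Measurable (fun q : Z l.castSucc × E l × X => layerG μE f p pX l q.1 q.2.1 q.2.2)) ∧
      (∀ (ε : ∀ i, E i) (x : X),
        0 < tailFn μE f p pX l.castSucc (latentCode z0 f ε l.castSucc) x →
        tailFn μE f p pX l.castSucc (latentCode z0 f ε l.castSucc) x < ∞ →
        tailIntegral μE l.succ (fun ε' => jointDensity z0 f p pX ε' x) ε =
          layerG μE f p pX l (latentCode z0 f ε l.castSucc) (ε l) x *
            tailIntegral μE l.castSucc (fun ε' => jointDensity z0 f p pX ε' x) ε) ∧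
      (∀ (w : Z l.castSucc) (x : X),
        0 < tailFn μE f p pX l.castSucc w x →
        tailFn μE f p pX l.castSucc w x < ∞ →
        ∫⁻ e, layerG μE f p pX l w e x ∂ μE l = 1) := by
  intro l
  have hT := measurable_tailFn μE hf hp hpX l.castSucc
  have hpT := measurable_prior_mul_tailFn μE hf hp hpX l
  refine ⟨?_, fun ε x h0 htop => ?_, fun w x h0 htop => ?_⟩
  · have hT' : Measurable (fun q : Z l.castSucc × E l × X =>
        tailFn μE f p pX l.castSucc q.1 q.2.2) :=
      hT.comp (measurable_fst.prodMk (measurable_snd.comp measurable_snd))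
    exact Measurable.ite ((measurableSet_lt measurable_const hT').inter
      (measurableSet_lt hT' measurable_const)) (hpT.div hT') measurable_const
  · rw [tailIntegral_jointDensity μE z0 hf hp hpX, tailIntegral_jointDensity μE z0 hf hp hpX,
      filter_castSucc_lt_succ, Finset.prod_insert (by simp), latentCode_succ, layerG,
      if_pos ⟨h0, htop⟩, mul_left_comm, ENNReal.div_mul_cancel h0.ne' htop.ne]
    ring
  · simp only [layerG, if_pos (And.intro h0 htop), div_eq_mul_inv]
    rw [lintegral_mul_const, ← tailFn_castSucc, ENNReal.mul_inv_cancel h0.ne' htop.ne]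
    exact hpT.comp (measurable_const.prodMk (measurable_id.prodMk measurable_const))
end

section
/- Let d_1, d_2, d_3, d_x, m_1, m_2 ∈ ℕ. Instantiate the hierarchical chain model with L = 3, E_l = ℝ^{d_l} with Lebesgue measure μ_l, X = ℝ^{d_x} with Lebesgue measure ν, Z_0 a singleton, Z_1 = ℝ^{m_1}, Z_2 = ℝ^{m_2}, Z_3 = ℝ^{m_3}, and suppose that the measure μ = ((μ_1 ⊗ μ_2 ⊗ μ_3) ⊗ ν).withDensity J on Ω = E_1 × E_2 × E_3 × X is a probability measure. Let ε_1, ε_2, ε_3, x denote the coordinate projections of Ω and let z_2 : Ω → Z_2 be ω ↦ f_2(f_1(z_0, ε_1(ω)), ε_2(ω)). Then, with respect to μ, the random variables ε_3 and ε_1 are conditionally independent given the σ-algebra generated by the pair (z_2, x). -/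
open MeasureTheory
open scoped ENNReal NNReal

/-- If conditioning the law of `Y` on a σ-algebra `m''` that contains `m'` and makes `W` measurable
yields `m'`-measurable conditional probabilities, then `Y` and `W` are conditionally independent
given `m'`. -/
theorem condIndepFun_of_condExp_ae_eq {Ω β γ : Type*} {m' m'' mΩ : MeasurableSpace Ω}
    [StandardBorelSpace Ω] [MeasurableSpace β] [MeasurableSpace γ] {μ : Measure Ω}
    [IsFiniteMeasure μ] (h' : m' ≤ m'') (h'' : m'' ≤ mΩ) {Y : Ω → β} {W : Ω → γ}
    (hY : Measurable Y) (hW : Measurable[m''] W)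
    (h : ∀ s, MeasurableSet s → ∃ g : Ω → ℝ, StronglyMeasurable[m'] g ∧
      μ[(Y ⁻¹' s).indicator (fun _ => (1 : ℝ)) | m''] =ᵐ[μ] g) :
    ProbabilityTheory.CondIndepFun m' (h'.trans h'') Y W μ := by
  rw [ProbabilityTheory.condIndepFun_iff_condExp_inter_preimage_eq_mul hY (hW.mono h'' le_rfl)]
  intro s t hs ht
  obtain ⟨g, hg, hgs⟩ := h s hs
  have hWt : MeasurableSet[m''] (W ⁻¹' t) := hW ht
  have intY : Integrable ((Y ⁻¹' s).indicator fun _ => (1 : ℝ)) μ :=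
    (integrable_const 1).indicator (hY hs)
  have intW : Integrable ((W ⁻¹' t).indicator fun _ => (1 : ℝ)) μ :=
    (integrable_const 1).indicator (h'' _ hWt)
  have intg : Integrable g μ := integrable_condExp.congr hgs
  have hYW : (Y ⁻¹' s ∩ W ⁻¹' t).indicator (fun _ => (1 : ℝ))
      = (W ⁻¹' t).indicator ((Y ⁻¹' s).indicator fun _ => (1 : ℝ)) := by
    rw [Set.indicator_indicator, Set.inter_comm]
  have hmul : (W ⁻¹' t).indicator g = g * (W ⁻¹' t).indicator fun _ => (1 : ℝ) := by
    ext ω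
    by_cases hω : ω ∈ W ⁻¹' t <;> simp [hω]
  have h1 : μ[(Y ⁻¹' s).indicator (fun _ => (1 : ℝ)) | m'] =ᵐ[μ] g :=
    calc μ[(Y ⁻¹' s).indicator (fun _ => (1 : ℝ)) | m']
      _ =ᵐ[μ] μ[μ[(Y ⁻¹' s).indicator (fun _ => (1 : ℝ)) | m''] | m'] :=
        (condExp_condExp_of_le h' h'').symm
      _ =ᵐ[μ] μ[g | m'] := condExp_congr_ae hgs
      _ =ᵐ[μ] g := by rw [condExp_of_stronglyMeasurable (h'.trans h'') hg intg]
  have h2 : μ[(Y ⁻¹' s ∩ W ⁻¹' t).indicator (fun _ => (1 : ℝ)) | m'']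
      =ᵐ[μ] g * (W ⁻¹' t).indicator fun _ => (1 : ℝ) := by
    rw [hYW, ← hmul]
    refine (condExp_indicator intY hWt).trans ?_
    filter_upwards [hgs] with ω hω
    by_cases hω' : ω ∈ W ⁻¹' t <;> simp [hω', hω]
  calc μ[(Y ⁻¹' s ∩ W ⁻¹' t).indicator (fun _ => (1 : ℝ)) | m']
    _ =ᵐ[μ] μ[μ[(Y ⁻¹' s ∩ W ⁻¹' t).indicator (fun _ => (1 : ℝ)) | m''] | m'] :=
      (condExp_condExp_of_le h' h'').symm
    _ =ᵐ[μ] μ[g * (W ⁻¹' t).indicator fun _ => (1 : ℝ) | m'] := condExp_congr_ae h2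
    _ =ᵐ[μ] g * μ[(W ⁻¹' t).indicator fun _ => (1 : ℝ) | m'] :=
      condExp_mul_of_stronglyMeasurable_left hg
        (hmul ▸ intg.indicator (h'' _ hWt)) intW
    _ =ᵐ[μ] _ := by
      filter_upwards [h1] with ω hω
      simp [hω]

/-- Fubini's theorem on `(A × B) × C`, integrating over the middle factor first. -/
theorem lintegral_prod_prod_middle {A B C : Type*} [MeasurableSpace A] [MeasurableSpace B]
    [MeasurableSpace C] (α : Measure A) (β : Measure B) (γ : Measure C) [SFinite β]
    [SFinite γ] {H : (A × B) × C → ℝ≥0∞} (hH : Measurable H) :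
    ∫⁻ ω, H ω ∂((α.prod β).prod γ) = ∫⁻ a, ∫⁻ c, ∫⁻ b, H ((a, b), c) ∂β ∂γ ∂α := by
  rw [lintegral_prod _ hH.aemeasurable, lintegral_prod _ hH.lintegral_prod_right'.aemeasurable]
  refine lintegral_congr fun a => lintegral_lintegral_swap ?_
  exact (hH.comp (by fun_prop : Measurable fun q : B × C => ((a, q.1), q.2))).aemeasurable

/-- If the density of `(w, e, x)` factors as `a w * q (Z w, x) e`, then `e` and `w` are
conditionally independent given `(Z w, x)`. -/
theorem condIndepFun_of_density_factor {A B C D : Type*} [MeasurableSpace A] [MeasurableSpace B]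
    [MeasurableSpace C] [MeasurableSpace D] [StandardBorelSpace A] [StandardBorelSpace B]
    [StandardBorelSpace C] (α : Measure A) (β : Measure B) (γ : Measure C) [SFinite β]
    [SFinite γ] {Z : A → D} (hZ : Measurable Z) {a : A → ℝ≥0∞} (ha : Measurable a)
    {q : (D × C) × B → ℝ≥0∞} (hq : Measurable q)
    (hqfin : ∀ z, ∫⁻ c, ∫⁻ b, q ((z, c), b) ∂β ∂γ ≠ ∞)
    {μ : Measure ((A × B) × C)} [IsFiniteMeasure μ]
    (hμ : μ = ((α.prod β).prod γ).withDensity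
      fun ω => a ω.1.1 * q ((Z ω.1.1, ω.2), ω.1.2))
    (hm : MeasurableSpace.comap (fun ω : (A × B) × C => (Z ω.1.1, ω.2)) inferInstance
      ≤ (inferInstance : MeasurableSpace ((A × B) × C))) :
    ProbabilityTheory.CondIndepFun
      (MeasurableSpace.comap (fun ω : (A × B) × C => (Z ω.1.1, ω.2)) inferInstance) hm
      (fun ω => ω.1.2) (fun ω => ω.1.1) μ := by
  have hV : Measurable fun ω : (A × B) × C => (ω.1.1, ω.2) := by fun_prop
  have h' : MeasurableSpace.comap (fun ω : (A × B) × C => (Z ω.1.1, ω.2)) inferInstance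
      ≤ MeasurableSpace.comap (fun ω : (A × B) × C => (ω.1.1, ω.2)) inferInstance := by
    rintro _ ⟨s, hs, rfl⟩
    exact ⟨(fun p : A × C => (Z p.1, p.2)) ⁻¹' s,
      (by fun_prop : Measurable fun p : A × C => (Z p.1, p.2)) hs, rfl⟩
  refine condIndepFun_of_condExp_ae_eq h' hV.comap_le (by fun_prop)
    (measurable_fst.comp (f := fun ω : (A × B) × C => (ω.1.1, ω.2)) (g := Prod.fst)
      (comap_measurable _)) ?_
  intro s hs
  let N : D × C → ℝ≥0∞ := fun p => ∫⁻ b, q (p, b) ∂β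
  let Ns : D × C → ℝ≥0∞ := fun p => ∫⁻ b in s, q (p, b) ∂β
  have mN : Measurable N := hq.lintegral_prod_right'
  have mNs : Measurable Ns := hq.lintegral_prod_right'
  have hle : ∀ p, Ns p ≤ N p := fun p => setLIntegral_le_lintegral _ _
  have hdiv_le : ∀ p, Ns p / N p ≤ 1 := fun p => ENNReal.div_le_of_le_mul (by simpa using hle p)
  have hcancel : ∀ p, N p ≠ ∞ → Ns p / N p * N p = Ns p := fun p hp =>
    ENNReal.div_mul_cancel' (fun h0 => le_antisymm (h0 ▸ hle p) zero_le) (fun h => absurd h hp)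
  have hfin : ∀ z, ∀ᵐ c ∂γ, N (z, c) ≠ ∞ := fun z => by
    filter_upwards [ae_lt_top (mN.comp measurable_prodMk_left) (hqfin z)] with c hc using hc.ne
  have mG : Measurable fun p => (Ns p / N p) := mNs.div mN
  have mJ : Measurable fun ω : (A × B) × C => a ω.1.1 * q ((Z ω.1.1, ω.2), ω.1.2) := by fun_prop
  have hs' : MeasurableSet ((fun ω : (A × B) × C => ω.1.2) ⁻¹' s) :=
    (by fun_prop : Measurable fun ω : (A × B) × C => ω.1.2) hs
  have key : ∀ T : Set (A × C), MeasurableSet T →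
      ∫⁻ ω in (fun ω : (A × B) × C => (ω.1.1, ω.2)) ⁻¹' T,
        (Ns (Z ω.1.1, ω.2) / N (Z ω.1.1, ω.2)) ∂μ
      = μ ((fun ω : (A × B) × C => ω.1.2) ⁻¹' s ∩
        (fun ω : (A × B) × C => (ω.1.1, ω.2)) ⁻¹' T) := by
    intro T hT
    have hT' := hV hT
    rw [hμ, withDensity_apply _ (hs'.inter hT'), restrict_withDensity hT',
      lintegral_withDensity_eq_lintegral_mul _ mJ (by fun_prop), ← lintegral_indicator hT',
      ← lintegral_indicator (hs'.inter hT'),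
      lintegral_prod_prod_middle _ _ _ (Measurable.indicator (by fun_prop) hT'),
      lintegral_prod_prod_middle _ _ _ (mJ.indicator (hs'.inter hT'))]
    refine lintegral_congr fun w => lintegral_congr_ae ?_
    filter_upwards [hfin (Z w)] with c hc
    have mq : Measurable fun b => q ((Z w, c), b) := hq.comp measurable_prodMk_left
    by_cases hwc : (w, c) ∈ T
    · trans a w * (Ns (Z w, c) / N (Z w, c) * N (Z w, c))
      · simp only [Set.indicator, Set.mem_preimage, hwc, if_true, Pi.mul_apply]
        rw [lintegral_mul_const _ (mq.const_mul _), lintegral_const_mul _ mq, mul_assoc,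
          mul_comm (N _)]
      · rw [hcancel _ hc]
        change a w * ∫⁻ b in s, q ((Z w, c), b) ∂β = _
        rw [← lintegral_indicator hs, ← lintegral_const_mul _ (mq.indicator hs)]
        refine lintegral_congr fun b => ?_
        by_cases hb : b ∈ s <;> simp [Set.indicator, hwc, hb]
    · simp [Set.indicator, hwc]
  have mg := mG.comp
    (comap_measurable (m := inferInstance) fun ω : (A × B) × C => (Z ω.1.1, ω.2))
  have mgΩ : Measurable fun ω : (A × B) × C => Ns (Z ω.1.1, ω.2) / N (Z ω.1.1, ω.2) := by fun_prop
  refine ⟨fun ω => (Ns (Z ω.1.1, ω.2) / N (Z ω.1.1, ω.2)).toReal,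
    mg.ennreal_toReal.stronglyMeasurable, ?_⟩
  have intg : Integrable
      (fun ω : (A × B) × C => (Ns (Z ω.1.1, ω.2) / N (Z ω.1.1, ω.2)).toReal) μ :=
    Integrable.of_bound mgΩ.ennreal_toReal.aestronglyMeasurable 1 (ae_of_all _ fun ω => by
      rw [Real.norm_of_nonneg ENNReal.toReal_nonneg]
      exact ENNReal.toReal_le_of_le_ofReal zero_le_one (by simpa using hdiv_le _))
  symm
  refine ae_eq_condExp_of_forall_setIntegral_eq hV.comap_le
    ((integrable_const 1).indicator hs') (fun _ _ _ => intg.integrableOn) ?_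
    (mg.ennreal_toReal.stronglyMeasurable.mono h').aestronglyMeasurable
  rintro _ ⟨T, hT, rfl⟩ -
  rw [integral_toReal mgΩ.aemeasurable
      (ae_of_all _ fun ω => (hdiv_le _).trans_lt ENNReal.one_lt_top),
    key T hT, integral_indicator hs', Measure.restrict_restrict hs']
  simp [Measure.real]

/-- **Bayes-ball claim of Figure 3.**  In the three-layer hierarchical chain model with
`E_l = ℝ^{d_l}` (Lebesgue measure), `X = ℝ^{d_x}` (Lebesgue measure), `Z_0` a singleton and
`Z_l = ℝ^{m_l}`, if the measure `μ = ((μ₁ ⊗ μ₂ ⊗ μ₃) ⊗ ν).withDensity J` built from the joint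
density `J(ε, x) = p₁(z₀, ε₁) p₂(z₁, ε₂) p₃(z₂, ε₃) p_X(z₃, x)` is a probability measure, then
the noise variables `ε₃` and `ε₁` are conditionally independent given the σ-algebra generated
by the pair `(z₂, x)`. -/
theorem condIndepFun_eps3_eps1_given_z2_x (d1 d2 d3 dx m1 m2 m3 : ℕ)
    (z0 : Unit)
    (f1 : Unit → (Fin d1 → ℝ) → (Fin m1 → ℝ))
    (f2 : (Fin m1 → ℝ) → (Fin d2 → ℝ) → (Fin m2 → ℝ))
    (f3 : (Fin m2 → ℝ) → (Fin d3 → ℝ) → (Fin m3 → ℝ))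
    (hf1 : Measurable (fun q : Unit × (Fin d1 → ℝ) => f1 q.1 q.2))
    (hf2 : Measurable (fun q : (Fin m1 → ℝ) × (Fin d2 → ℝ) => f2 q.1 q.2))
    (hf3 : Measurable (fun q : (Fin m2 → ℝ) × (Fin d3 → ℝ) => f3 q.1 q.2))
    (hbij1 : ∀ w, Function.Bijective (f1 w))
    (hbij2 : ∀ w, Function.Bijective (f2 w))
    (hbij3 : ∀ w, Function.Bijective (f3 w))
    (p1 : Unit → (Fin d1 → ℝ) → ℝ≥0)
    (p2 : (Fin m1 → ℝ) → (Fin d2 → ℝ) → ℝ≥0)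
    (p3 : (Fin m2 → ℝ) → (Fin d3 → ℝ) → ℝ≥0)
    (pX : (Fin m3 → ℝ) → (Fin dx → ℝ) → ℝ≥0)
    (hp1 : Measurable (fun q : Unit × (Fin d1 → ℝ) => p1 q.1 q.2))
    (hp2 : Measurable (fun q : (Fin m1 → ℝ) × (Fin d2 → ℝ) => p2 q.1 q.2))
    (hp3 : Measurable (fun q : (Fin m2 → ℝ) × (Fin d3 → ℝ) => p3 q.1 q.2))
    (hpX : Measurable (fun q : (Fin m3 → ℝ) × (Fin dx → ℝ) => pX q.1 q.2))
    (hp1n : ∀ w, ∫⁻ e, (p1 w e : ℝ≥0∞) = 1)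
    (hp2n : ∀ w, ∫⁻ e, (p2 w e : ℝ≥0∞) = 1)
    (hp3n : ∀ w, ∫⁻ e, (p3 w e : ℝ≥0∞) = 1)
    (hpXn : ∀ z, ∫⁻ x, (pX z x : ℝ≥0∞) = 1)
    (J : (((Fin d1 → ℝ) × (Fin d2 → ℝ)) × (Fin d3 → ℝ)) × (Fin dx → ℝ) → ℝ≥0∞)
    (hJ : J = fun ω =>
      (p1 z0 ω.1.1.1 : ℝ≥0∞) * (p2 (f1 z0 ω.1.1.1) ω.1.1.2 : ℝ≥0∞) *
        (p3 (f2 (f1 z0 ω.1.1.1) ω.1.1.2) ω.1.2 : ℝ≥0∞) *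
        (pX (f3 (f2 (f1 z0 ω.1.1.1) ω.1.1.2) ω.1.2) ω.2 : ℝ≥0∞))
    (μ : Measure ((((Fin d1 → ℝ) × (Fin d2 → ℝ)) × (Fin d3 → ℝ)) × (Fin dx → ℝ)))
    (hμ : μ = ((((volume : Measure (Fin d1 → ℝ)).prod (volume : Measure (Fin d2 → ℝ))).prod
        (volume : Measure (Fin d3 → ℝ))).prod (volume : Measure (Fin dx → ℝ))).withDensity J)
    [IsProbabilityMeasure μ] :
    ProbabilityTheory.CondIndepFun
      (MeasurableSpace.comap
        (fun ω : (((Fin d1 → ℝ) × (Fin d2 → ℝ)) × (Fin d3 → ℝ)) × (Fin dx → ℝ) =>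
          (f2 (f1 z0 ω.1.1.1) ω.1.1.2, ω.2)) inferInstance)
      (Measurable.comap_le (by fun_prop))
      (fun ω => ω.1.2) (fun ω => ω.1.1.1) μ := by
  have mf1 : Measurable (f1 z0) := hf1.comp measurable_prodMk_left
  have mp1 : Measurable (p1 z0) := hp1.comp measurable_prodMk_left
  have mZ : Measurable fun w : (Fin d1 → ℝ) × (Fin d2 → ℝ) => f2 (f1 z0 w.1) w.2 :=
    hf2.comp ((mf1.comp measurable_fst).prodMk measurable_snd)
  have ma : Measurable fun w : (Fin d1 → ℝ) × (Fin d2 → ℝ) =>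
      (p1 z0 w.1 : ℝ≥0∞) * (p2 (f1 z0 w.1) w.2 : ℝ≥0∞) :=
    (mp1.comp measurable_fst).coe_nnreal_ennreal.mul
      (hp2.comp ((mf1.comp measurable_fst).prodMk measurable_snd)).coe_nnreal_ennreal
  have mq : Measurable fun r : ((Fin m2 → ℝ) × (Fin dx → ℝ)) × (Fin d3 → ℝ) =>
      (p3 r.1.1 r.2 : ℝ≥0∞) * (pX (f3 r.1.1 r.2) r.1.2 : ℝ≥0∞) := by
    have mze : Measurable fun r : ((Fin m2 → ℝ) × (Fin dx → ℝ)) × (Fin d3 → ℝ) => (r.1.1, r.2) := by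
      fun_prop
    exact (hp3.comp mze).coe_nnreal_ennreal.mul
      (hpX.comp ((hf3.comp mze).prodMk (by fun_prop))).coe_nnreal_ennreal
  refine (condIndepFun_of_density_factor (volume.prod volume) volume volume mZ ma mq (fun z => ?_)
    (hμ.trans ?_) _).comp measurable_id measurable_fst
  · rw [lintegral_lintegral_swap
      (f := fun x e => (p3 z e : ℝ≥0∞) * (pX (f3 z e) x : ℝ≥0∞)) (mq.comp (by fun_prop : Measurable fun r : (Fin dx → ℝ) × (Fin d3 → ℝ) =>
        ((z, r.1), r.2))).aemeasurable]
    have hX : ∀ e, ∫⁻ x, (p3 z e : ℝ≥0∞) * (pX (f3 z e) x : ℝ≥0∞) = p3 z e := fun e => by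
      have mX : Measurable (pX (f3 z e)) := hpX.comp measurable_prodMk_left
      rw [lintegral_const_mul _ mX.coe_nnreal_ennreal, hpXn, mul_one]
    simp [hX, hp3n]
  · simp only [hJ, mul_assoc]
end
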